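/- Let s > 0 be the unique positive root of s = coth(s) and let k ≥ 1 be an integer. For every real β with 0 < β ≤ 1 and every T > 0, the (2k−1)-th normalized Steklov eigenvalue satisfies σ̃_{2k−1}(β,T) ≤ 4kπ/s, with equality if and only if β = 1 and T = 2s/k. Consequently sup over all β ∈ (0,1] and T > 0 of σ̃_{2k−1}(β,T) equals 4kπ/s. -/

import Mathlib

open Real

/-- The hyperbolic cotangent. -/
noncomputable def coth (t : ℝ) : ℝ := Real.cosh t / Real.sinh t

/-- The normalized Steklov eigenvalues `λ̃_n(β,T)` (for `n ≥ 1`). -/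
noncomputable def lamS (n : ℕ) (β T : ℝ) : ℝ :=
  (4 * n * π / β) * (coth (n * T) - Real.sqrt ((coth (n * T)) ^ 2 - β))

/-- The normalized Steklov eigenvalues `μ̃_n(β,T)` (with `μ̃_0(β,T) = 8π/(Tβ)`). -/
noncomputable def muS (n : ℕ) (β T : ℝ) : ℝ :=
  if n = 0 then 8 * π / (T * β)
  else (4 * n * π / β) * (coth (n * T) + Real.sqrt ((coth (n * T)) ^ 2 - β))

/-- The `j`-th smallest normalized Steklov eigenvalue, counted with multiplicity:
`μ̃_0` has multiplicity one, and each `λ̃_n`, `μ̃_n` (`n ≥ 1`) has multiplicity two. -/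
noncomputable def sigmaS (β T : ℝ) (j : ℕ) : ℝ :=
  sInf { x : ℝ |
    j ≤ 2 * {n : ℕ | 1 ≤ n ∧ lamS n β T ≤ x}.ncard
      + 2 * {n : ℕ | 1 ≤ n ∧ muS n β T ≤ x}.ncard
      + (if muS 0 β T ≤ x then 1 else 0) }

open Filter Topology

lemma pos_of_hasDerivAt_pos {f f' : ℝ → ℝ} (hf : ∀ t, HasDerivAt f (f' t) t) (h0 : f 0 = 0)
    (hpos : ∀ t, 0 < t → 0 < f' t) {t : ℝ} (ht : 0 < t) : 0 < f t := by
  have hmono : StrictMonoOn f (Set.Ici 0) := by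
    refine strictMonoOn_of_deriv_pos (convex_Ici 0)
      (fun x _ => (hf x).continuousAt.continuousWithinAt) fun x hx => ?_
    rw [interior_Ici] at hx
    rw [(hf x).deriv]
    exact hpos x hx
  have := hmono (Set.self_mem_Ici) (Set.mem_Ici.2 ht.le) ht
  rwa [h0] at this

lemma sinh_lt_mul_cosh {t : ℝ} (ht : 0 < t) : sinh t < t * cosh t := by
  have := pos_of_hasDerivAt_pos (f := fun t => t * cosh t - sinh t) (f' := fun t => t * sinh t)
    (fun t => by
      have := ((hasDerivAt_id t).mul (hasDerivAt_cosh t)).sub (hasDerivAt_sinh t)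
      refine this.congr_deriv ?_
      simp) (by simp) (fun t ht => mul_pos ht (sinh_pos_iff.2 ht)) ht
  linarith

lemma two_mul_cosh_lt {t : ℝ} (ht : 0 < t) : 2 * cosh t < t * sinh t + 2 := by
  have := pos_of_hasDerivAt_pos (f := fun t => t * sinh t + 2 - 2 * cosh t)
    (f' := fun t => t * cosh t - sinh t)
    (fun t => by
      have := (((hasDerivAt_id t).mul (hasDerivAt_sinh t)).add_const 2).sub
        ((hasDerivAt_cosh t).const_mul 2)
      refine this.congr_deriv ?_
      simp
      ring) (by simp) (fun t ht => by linarith [sinh_lt_mul_cosh ht]) ht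
  linarith

lemma three_mul_sinh_lt {t : ℝ} (ht : 0 < t) : 3 * sinh t < t * cosh t + 2 * t := by
  have := pos_of_hasDerivAt_pos (f := fun t => t * cosh t + 2 * t - 3 * sinh t)
    (f' := fun t => t * sinh t + 2 - 2 * cosh t)
    (fun t => by
      have := (((hasDerivAt_id t).mul (hasDerivAt_cosh t)).add
        ((hasDerivAt_id t).const_mul 2)).sub ((hasDerivAt_sinh t).const_mul 3)
      refine this.congr_deriv ?_
      simp
      ring) (by simp) (fun t ht => by linarith [two_mul_cosh_lt ht]) ht
  linarith

lemma four_mul_cosh_lt {t : ℝ} (ht : 0 < t) : 4 * cosh t < t * sinh t + t ^ 2 + 4 := by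
  have := pos_of_hasDerivAt_pos (f := fun t => t * sinh t + t ^ 2 + 4 - 4 * cosh t)
    (f' := fun t => t * cosh t + 2 * t - 3 * sinh t)
    (fun t => by
      have := ((((hasDerivAt_id t).mul (hasDerivAt_sinh t)).add
        ((hasDerivAt_id t).pow 2)).add_const 4).sub ((hasDerivAt_cosh t).const_mul 4)
      refine this.congr_deriv ?_
      simp
      ring) (by simp) (fun t ht => by linarith [three_mul_sinh_lt ht]) ht
  linarith

lemma two_mul_sinh_sq_lt {t : ℝ} (ht : 0 < t) :
    2 * sinh t ^ 2 < t * cosh t * sinh t + t ^ 2 := by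
  have h := four_mul_cosh_lt (t := 2 * t) (by positivity)
  rw [cosh_two_mul, sinh_two_mul] at h
  nlinarith [cosh_sq t]

lemma hasDerivAt_coth {t : ℝ} (ht : 0 < t) : HasDerivAt coth (-1 / sinh t ^ 2) t := by
  have hs : sinh t ≠ 0 := (sinh_pos_iff.2 ht).ne'
  refine ((hasDerivAt_cosh t).div (hasDerivAt_sinh t) hs).congr_deriv ?_
  congr 1
  nlinarith [cosh_sq t]

lemma one_lt_coth {t : ℝ} (ht : 0 < t) : 1 < coth t := by
  rw [coth, one_lt_div (sinh_pos_iff.2 ht)]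
  exact sinh_lt_cosh t

lemma one_lt_mul_coth {t : ℝ} (ht : 0 < t) : 1 < t * coth t := by
  rw [coth, ← mul_div_assoc, one_lt_div (sinh_pos_iff.2 ht)]
  exact sinh_lt_mul_cosh ht

lemma coth_strictAntiOn : StrictAntiOn coth (Set.Ioi 0) := by
  refine strictAntiOn_of_deriv_neg (convex_Ioi 0)
    (fun x hx => (hasDerivAt_coth hx).continuousAt.continuousWithinAt) fun x hx => ?_
  rw [interior_Ioi] at hx
  rw [(hasDerivAt_coth hx).deriv]
  have := sinh_pos_iff.2 hx
  exact div_neg_of_neg_of_pos (by norm_num) (by positivity)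

lemma coth_two_mul {t : ℝ} (ht : 0 < t) : 2 * coth (2 * t) = coth t + 1 / coth t := by
  have hs := (sinh_pos_iff.2 ht).ne'
  have hc := (cosh_pos t).ne'
  rw [coth, coth, cosh_two_mul, sinh_two_mul]
  field_simp

/-- The Langevin function is strictly increasing. -/
lemma coth_sub_inv_strictMonoOn : StrictMonoOn (fun t => coth t - t⁻¹) (Set.Ioi 0) := by
  have hd : ∀ x : ℝ, 0 < x →
      HasDerivAt (fun t => coth t - t⁻¹) (-1 / sinh x ^ 2 - -(x ^ 2)⁻¹) x :=
    fun x hx => (hasDerivAt_coth hx).sub (hasDerivAt_inv hx.ne')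
  refine strictMonoOn_of_deriv_pos (convex_Ioi 0)
    (fun x hx => (hd x hx).continuousAt.continuousWithinAt) fun x hx => ?_
  rw [interior_Ioi] at hx
  have hx : 0 < x := hx
  rw [(hd x hx).deriv]
  have h1 : x < sinh x := self_lt_sinh_iff.2 hx
  have h2 : 1 / sinh x ^ 2 < 1 / x ^ 2 :=
    one_div_lt_one_div_of_lt (by positivity) (by gcongr)
  rw [neg_div, ← one_div]
  linarith

/-- The quotient of the Langevin function by its argument is strictly decreasing. -/
lemma coth_sub_inv_div_strictAntiOn :
    StrictAntiOn (fun t => (coth t - t⁻¹) / t) (Set.Ioi 0) := by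
  have hd : ∀ x : ℝ, 0 < x → HasDerivAt (fun t => (coth t - t⁻¹) / t)
      (((-1 / sinh x ^ 2 - -(x ^ 2)⁻¹) * x - (coth x - x⁻¹) * 1) / x ^ 2) x :=
    fun x hx => ((hasDerivAt_coth hx).sub (hasDerivAt_inv hx.ne')).div (hasDerivAt_id x) hx.ne'
  refine strictAntiOn_of_deriv_neg (convex_Ioi 0)
    (fun x hx => (hd x hx).continuousAt.continuousWithinAt) fun x hx => ?_
  rw [interior_Ioi] at hx
  have hx : 0 < x := hx
  rw [(hd x hx).deriv]
  have hs := sinh_pos_iff.2 hx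
  refine div_neg_of_neg_of_pos ?_ (by positivity)
  have h : (-1 / sinh x ^ 2 - -(x ^ 2)⁻¹) * x - (coth x - x⁻¹) * 1
      = (2 * sinh x ^ 2 - (x * cosh x * sinh x + x ^ 2)) / (x * sinh x ^ 2) := by
    rw [coth]
    field_simp
    ring
  rw [h]
  exact div_neg_of_neg_of_pos (by linarith [two_mul_sinh_sq_lt hx]) (by positivity)

lemma cosh_sub_cosh_lt {s U V : ℝ} (hV : 0 < V) (hVU : V < U)
    (hs : s ≤ 2 * (coth U - U⁻¹)) :
    s * V * (cosh U - cosh V) < 2 * (V * sinh U - U * sinh V) := by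
  have hU := hV.trans hVU
  have hd : ∀ x : ℝ, 0 < x → HasDerivAt (fun t => s * cosh t - 2 * U * (sinh t / t))
      (s * sinh x - 2 * U * ((cosh x * x - sinh x * 1) / x ^ 2)) x := fun x hx =>
    ((hasDerivAt_cosh x).const_mul s).sub
      (((hasDerivAt_sinh x).div (hasDerivAt_id x) hx.ne').const_mul (2 * U))
  have hanti : StrictAntiOn (fun t => s * cosh t - 2 * U * (sinh t / t)) (Set.Icc V U) := by
    refine strictAntiOn_of_deriv_neg (convex_Icc V U)
      (fun x hx => (hd x (hV.trans_le hx.1)).continuousAt.continuousWithinAt) fun x hx => ?_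
    rw [interior_Icc] at hx
    have hx0 : 0 < x := hV.trans hx.1
    rw [(hd x hx0).deriv]
    have hsx := sinh_pos_iff.2 hx0
    have h1 : (coth U - U⁻¹) / U < (coth x - x⁻¹) / x :=
      coth_sub_inv_div_strictAntiOn (Set.mem_Ioi.2 hx0) (Set.mem_Ioi.2 hU) hx.2
    have h2 : s < 2 * U * ((coth x - x⁻¹) / x) := by
      rw [div_lt_iff₀ hU] at h1
      linarith
    have h3 : (cosh x * x - sinh x * 1) / x ^ 2 = sinh x * ((coth x - x⁻¹) / x) := by
      rw [coth]
      field_simp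
    rw [h3]
    nlinarith
  have h := hanti (Set.left_mem_Icc.2 hVU.le) (Set.right_mem_Icc.2 hVU.le) hVU
  simp only at h
  have h4 : 2 * U * (sinh U / U) = 2 * sinh U := by field_simp
  rw [h4] at h
  have h5 : V * (2 * U * (sinh V / V)) = 2 * U * sinh V := by field_simp
  nlinarith

lemma mul_coth_sub_mul_coth {s a b : ℝ} (hb : 0 < b) (hba : b < a)
    (hs : s ≤ 2 * (coth (a + b) - (a + b)⁻¹)) :
    s / 2 * (a - b) < a * coth a - b * coth b := by
  have hsa := sinh_pos_iff.2 (hb.trans hba)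
  have hsb := sinh_pos_iff.2 hb
  have h := cosh_sub_cosh_lt (U := a + b) (V := a - b) (by linarith) (by linarith) hs
  rw [cosh_add, cosh_sub, sinh_add, sinh_sub] at h
  have h1 : a * coth a - b * coth b
      = (a * cosh a * sinh b - b * cosh b * sinh a) / (sinh a * sinh b) := by
    rw [coth, coth]
    field_simp
  rw [h1, lt_div_iff₀ (by positivity)]
  linarith

lemma coth_add_sqrt_one {t : ℝ} (ht : 0 < t) :
    coth (2 * t) + √(coth (2 * t) ^ 2 - 1) = coth t := by
  have hs := sinh_pos_iff.2 ht
  have hc := cosh_pos t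
  have h2 : coth (2 * t) ^ 2 - 1 = (1 / sinh (2 * t)) ^ 2 := by
    have : sinh (2 * t) ≠ 0 := by rw [sinh_two_mul]; positivity
    rw [coth, div_pow, one_div, inv_pow]
    field_simp
    linarith [cosh_sq (2 * t)]
  rw [h2, sqrt_sq (by rw [sinh_two_mul]; positivity), coth, coth, cosh_two_mul, sinh_two_mul]
  field_simp
  linarith [cosh_sq t]

lemma lt_two_of_eq_coth {s : ℝ} (hs : 0 < s) (hsc : s = coth s) : s < 2 := by
  by_contra! h
  have h1 : s < sinh s := self_lt_sinh_iff.2 hs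
  have h2 : s * sinh s = cosh s := by
    nth_rewrite 1 [hsc]
    rw [coth, div_mul_cancel₀ _ (sinh_pos_iff.2 hs).ne']
  have h3 : cosh s - sinh s = exp (-s) := cosh_sub_sinh s
  have h4 : exp (-s) < 1 := exp_lt_one_iff.2 (by linarith)
  nlinarith

lemma lt_two_mul_coth_sub_inv {s u : ℝ} (hs : 0 < s) (hsc : s = coth s) (hu : s < u) :
    s < 2 * (coth (2 * u) - (2 * u)⁻¹) := by
  have h : coth (2 * s) - (2 * s)⁻¹ < coth (2 * u) - (2 * u)⁻¹ :=
    coth_sub_inv_strictMonoOn (Set.mem_Ioi.2 (by positivity))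
      (Set.mem_Ioi.2 (by linarith)) (by linarith)
  have h2 := coth_two_mul hs
  rw [← hsc] at h2
  have h3 : 2 * (2 * s)⁻¹ = 1 / s := by field_simp
  linarith

/-- Either `λ̃` at the larger frequency or `μ̃` at the complementary one lies below the bound. -/
lemma lt_coth_add_sqrt_or {s w β ξ η : ℝ} (hs : 0 < s) (hsc : s = coth s) (hw : 1 < w)
    (hβ : β ≤ 1) (hξ : 0 < ξ) (hη : 0 < η) (hsum : ξ + η = s) :
    ξ < coth (2 * ξ * w) + √(coth (2 * ξ * w) ^ 2 - β) ∨
      η * (coth (2 * η * w) + √(coth (2 * η * w) ^ 2 - β)) < β := by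
  by_contra! ⟨h1, h2⟩
  have hw0 : 0 < w := by linarith
  have hs2 := lt_two_of_eq_coth hs hsc
  have hc1 := one_lt_coth (t := 2 * ξ * w) (by positivity)
  have hc2 := one_lt_coth (t := 2 * η * w) (by positivity)
  have hlt := lt_two_mul_coth_sub_inv hs hsc (u := s * w) (by nlinarith)
  have key := mul_coth_sub_mul_coth (s := s) (a := 2 * ξ * w) (b := 2 * η * w) (by positivity)
    (by
      have := sqrt_nonneg (coth (2 * ξ * w) ^ 2 - β)
      have : η < ξ := by linarith
      gcongr)
    (by
      rw [show 2 * ξ * w + 2 * η * w = 2 * (s * w) by rw [← hsum]; ring]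
      exact hlt.le)
  set c₁ := coth (2 * ξ * w)
  set c₂ := coth (2 * η * w)
  have hr1 := sq_sqrt (show 0 ≤ c₁ ^ 2 - β by nlinarith)
  have hr2 := sq_sqrt (show 0 ≤ c₂ ^ 2 - β by nlinarith)
  have hn1 := sqrt_nonneg (c₁ ^ 2 - β)
  have hn2 := sqrt_nonneg (c₂ ^ 2 - β)
  set r₁ := √(c₁ ^ 2 - β)
  set r₂ := √(c₂ ^ 2 - β)
  have hβ1 : 2 * ξ * c₁ - ξ ^ 2 ≤ β := by nlinarith
  have hcmp : 2 * η * c₂ - η ^ 2 < 2 * ξ * c₁ - ξ ^ 2 := by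
    rw [← hsum] at key
    have : 0 < w * ((2 * ξ * c₁ - ξ ^ 2) - (2 * η * c₂ - η ^ 2)) := by linarith
    linarith [(mul_pos_iff_of_pos_left hw0).1 this]
  have hβ2 : 2 * η * c₂ < β + η ^ 2 := by linarith
  have hη1 : η < 1 := by linarith
  have hpos : η * c₂ < β := by
    by_contra! h
    have : η * c₂ < η * η := by linarith
    linarith [lt_of_mul_lt_mul_left this hη.le]
  have hβ0 : 0 < β := (by positivity : 0 < η * c₂).trans hpos
  have : (η * r₂) ^ 2 < (β - η * c₂) ^ 2 := by
    rw [mul_pow, hr2]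
    nlinarith
  have := lt_of_pow_lt_pow_left₀ 2 (by linarith) this
  linarith

/-- The complementary pair with zero second frequency. -/
lemma lt_coth_add_sqrt_of_mul_le {s w β : ℝ} (hs : 0 < s) (hsc : s = coth s) (hw : 1 < w)
    (_hβ : β ≤ 1) (hβw : β * w ≤ 1) :
    s < coth (2 * s * w) + √(coth (2 * s * w) ^ 2 - β) := by
  have hw0 : 0 < w := by linarith
  have hlt := lt_two_mul_coth_sub_inv hs hsc (u := s * w) (by nlinarith)
  rw [← mul_assoc] at hlt
  have hc := one_lt_coth (t := 2 * s * w) (by positivity)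
  set c := coth (2 * s * w)
  have hr := sq_sqrt (show 0 ≤ c ^ 2 - β by nlinarith)
  have hn := sqrt_nonneg (c ^ 2 - β)
  set r := √(c ^ 2 - β)
  by_contra! h
  have h1 : 2 * s * c ≤ s ^ 2 + β := by nlinarith
  have h2 : s * w * (2 * (2 * s * w)⁻¹) = 1 := by field_simp
  have h3 := mul_lt_mul_of_pos_left hlt (show 0 < s * w by positivity)
  nlinarith

lemma coth_nat_mul_gt_one {n : ℕ} {T : ℝ} (hn : 1 ≤ n) (hT : 0 < T) : 1 < coth (n * T) :=
  one_lt_coth (mul_pos (by exact_mod_cast hn) hT)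

lemma lamS_eq {n : ℕ} {β T : ℝ} (hn : 1 ≤ n) (hβ : 0 < β) (hβ1 : β ≤ 1) (hT : 0 < T) :
    lamS n β T = 4 * n * π / (coth (n * T) + √(coth (n * T) ^ 2 - β)) := by
  have hc := coth_nat_mul_gt_one hn hT
  rw [lamS]
  set c := coth (n * T)
  have hr := sq_sqrt (show 0 ≤ c ^ 2 - β by nlinarith)
  have hn := sqrt_nonneg (c ^ 2 - β)
  set r := √(c ^ 2 - β)
  rw [eq_div_iff (by positivity), div_mul_eq_mul_div, div_mul_eq_mul_div, div_eq_iff hβ.ne']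
  linear_combination -4 * n * π * hr

lemma muS_eq {n : ℕ} (hn : 1 ≤ n) (β T : ℝ) :
    muS n β T = 4 * n * π / β * (coth (n * T) + √(coth (n * T) ^ 2 - β)) := by
  rw [muS, if_neg (by omega)]

lemma lamS_pos {n : ℕ} {β T : ℝ} (hn : 1 ≤ n) (hβ : 0 < β) (hβ1 : β ≤ 1) (hT : 0 < T) :
    0 < lamS n β T := by
  have hc := coth_nat_mul_gt_one hn hT
  have : (0 : ℝ) < n := by exact_mod_cast hn
  rw [lamS_eq hn hβ hβ1 hT]
  positivity

lemma muS_pos {n : ℕ} {β T : ℝ} (hβ : 0 < β) (hT : 0 < T) : 0 < muS n β T := by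
  rcases Nat.eq_zero_or_pos n with rfl | hn
  · rw [muS, if_pos rfl]
    positivity
  · have hc := coth_nat_mul_gt_one hn hT
    have : (0 : ℝ) < n := by exact_mod_cast hn
    rw [muS_eq hn]
    positivity

lemma coth_nat_mul_anti {m n : ℕ} {T : ℝ} (hm : 1 ≤ m) (hmn : m ≤ n) (hT : 0 < T) :
    coth (n * T) ≤ coth (m * T) := by
  have hm0 : (0 : ℝ) < m := by exact_mod_cast hm
  have hmn' : (m : ℝ) ≤ n := by exact_mod_cast hmn
  refine coth_strictAntiOn.antitoneOn (Set.mem_Ioi.2 (by positivity))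
    (Set.mem_Ioi.2 (by nlinarith)) (by gcongr)

lemma coth_add_sqrt_anti {m n : ℕ} {T β : ℝ} (hm : 1 ≤ m) (hmn : m ≤ n) (hT : 0 < T) :
    coth (n * T) + √(coth (n * T) ^ 2 - β) ≤ coth (m * T) + √(coth (m * T) ^ 2 - β) := by
  have h := coth_nat_mul_anti hm hmn hT
  have hc := coth_nat_mul_gt_one (hm.trans hmn) hT
  gcongr

lemma lamS_mono {m n : ℕ} {β T : ℝ} (hm : 1 ≤ m) (hmn : m ≤ n) (hβ : 0 < β) (hβ1 : β ≤ 1)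
    (hT : 0 < T) : lamS m β T ≤ lamS n β T := by
  have hc := coth_nat_mul_gt_one (hm.trans hmn) hT
  rw [lamS_eq hm hβ hβ1 hT, lamS_eq (hm.trans hmn) hβ hβ1 hT]
  have := coth_add_sqrt_anti (β := β) hm hmn hT
  gcongr

lemma finite_lamS_le {β T : ℝ} (hβ : 0 < β) (hβ1 : β ≤ 1) (hT : 0 < T) (x : ℝ) :
    {n : ℕ | 1 ≤ n ∧ lamS n β T ≤ x}.Finite := by
  have hc := coth_nat_mul_gt_one le_rfl hT
  set d := coth ((1 : ℕ) * T) + √(coth ((1 : ℕ) * T) ^ 2 - β)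
  have hd0 : 0 < d := by positivity
  refine (Set.finite_Iic ⌊x * d / (4 * π)⌋₊).subset fun n ⟨hn, hx⟩ => ?_
  have hcn := coth_nat_mul_gt_one hn hT
  refine Nat.le_floor ?_
  rw [lamS_eq hn hβ hβ1 hT] at hx
  have h1 : 4 * n * π / d ≤ x := by
    refine le_trans ?_ hx
    have := coth_add_sqrt_anti (β := β) le_rfl hn hT
    gcongr
  rw [div_le_iff₀ hd0] at h1
  rw [le_div_iff₀ (by positivity)]
  linarith

lemma finite_muS_le {β T : ℝ} (hβ : 0 < β) (hβ1 : β ≤ 1) (hT : 0 < T) (x : ℝ) :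
    {n : ℕ | 1 ≤ n ∧ muS n β T ≤ x}.Finite := by
  refine (finite_lamS_le hβ hβ1 hT x).subset fun n ⟨hn, hx⟩ => ⟨hn, le_trans ?_ hx⟩
  rw [muS_eq hn, lamS]
  have := sqrt_nonneg (coth (n * T) ^ 2 - β)
  gcongr
  linarith

lemma lamS_lt {n k : ℕ} {β T s : ℝ} (hn : 1 ≤ n) (hk : 1 ≤ k) (hβ : 0 < β) (hβ1 : β ≤ 1)
    (hT : 0 < T) (hs : 0 < s)
    (h : n * s / k < coth (n * T) + √(coth (n * T) ^ 2 - β)) :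
    lamS n β T < 4 * k * π / s := by
  have hc := coth_nat_mul_gt_one hn hT
  have hk0 : (0 : ℝ) < k := by exact_mod_cast hk
  rw [lamS_eq hn hβ hβ1 hT, div_lt_div_iff₀ (by positivity) hs]
  rw [div_lt_iff₀ hk0] at h
  nlinarith [pi_pos]

lemma muS_lt {n k : ℕ} {β T s : ℝ} (hn : 1 ≤ n) (hk : 1 ≤ k) (hβ : 0 < β) (hs : 0 < s)
    (h : n * s / k * (coth (n * T) + √(coth (n * T) ^ 2 - β)) < β) :
    muS n β T < 4 * k * π / s := by
  have hk0 : (0 : ℝ) < k := by exact_mod_cast hk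
  rw [muS_eq hn, div_mul_eq_mul_div, div_lt_div_iff₀ hβ hs]
  rw [div_mul_eq_mul_div, div_lt_iff₀ hk0] at h
  nlinarith [pi_pos]

lemma sigmaS_le {β T x : ℝ} {j : ℕ} (hj : 1 ≤ j) (hβ : 0 < β) (hβ1 : β ≤ 1) (hT : 0 < T)
    (hx : j ≤ 2 * {n : ℕ | 1 ≤ n ∧ lamS n β T ≤ x}.ncard
      + 2 * {n : ℕ | 1 ≤ n ∧ muS n β T ≤ x}.ncard
      + (if muS 0 β T ≤ x then 1 else 0)) : sigmaS β T j ≤ x := by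
  refine csInf_le ⟨0, fun y hy => ?_⟩ hx
  by_contra! hy0
  have h1 : {n : ℕ | 1 ≤ n ∧ lamS n β T ≤ y} = ∅ := by
    ext n
    simp only [Set.mem_ofPred_eq, Set.mem_empty_iff_false, iff_false, not_and, not_le]
    exact fun hn => hy0.trans (lamS_pos hn hβ hβ1 hT)
  have h2 : {n : ℕ | 1 ≤ n ∧ muS n β T ≤ y} = ∅ := by
    ext n
    simp only [Set.mem_ofPred_eq, Set.mem_empty_iff_false, iff_false, not_and, not_le]
    exact fun _ => hy0.trans (muS_pos hβ hT)
  have h3 : ¬ muS 0 β T ≤ y := not_le.2 (hy0.trans (muS_pos hβ hT))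
  simp only [Set.mem_ofPred_eq, h1, h2, h3, Set.ncard_empty, if_false] at hy
  omega

lemma le_ncard_lamS_le {β T : ℝ} (k : ℕ) (hβ : 0 < β) (hβ1 : β ≤ 1) (hT : 0 < T) :
    k ≤ {n : ℕ | 1 ≤ n ∧ lamS n β T ≤ lamS k β T}.ncard := by
  have h : ((Finset.Icc 1 k : Finset ℕ) : Set ℕ) ⊆
      {n : ℕ | 1 ≤ n ∧ lamS n β T ≤ lamS k β T} := by
    intro n hn
    simp only [Finset.coe_Icc, Set.mem_Icc] at hn
    exact ⟨hn.1, lamS_mono hn.1 hn.2 hβ hβ1 hT⟩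
  have := Set.ncard_le_ncard h (finite_lamS_le hβ hβ1 hT _)
  rwa [Set.ncard_coe_finset, Nat.card_Icc, Nat.add_sub_cancel] at this

lemma sigmaS_le_lamS {β T : ℝ} {k : ℕ} (hk : 1 ≤ k) (hβ : 0 < β) (hβ1 : β ≤ 1) (hT : 0 < T) :
    sigmaS β T (2 * k - 1) ≤ lamS k β T := by
  refine sigmaS_le (by omega) hβ hβ1 hT ?_
  have := le_ncard_lamS_le k hβ hβ1 hT
  omega

lemma sigmaS_lt_of_pairs {β T X : ℝ} {k : ℕ} (hk : 1 ≤ k) (hβ : 0 < β) (hβ1 : β ≤ 1)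
    (hT : 0 < T) (h0 : muS 0 β T < X)
    (hpair : ∀ n : ℕ, 1 ≤ n → n < k → lamS (k - n) β T < X ∨ muS n β T < X) :
    sigmaS β T (2 * k - 1) < X := by
  have hle : ∀ {v : ℝ}, v < X → ∀ᶠ x in 𝓝[<] X, v ≤ x := fun hv =>
    eventually_nhdsWithin_of_eventually_nhds (eventually_ge_nhds hv)
  have hev : ∀ᶠ x in 𝓝[<] X, ∀ n ∈ Finset.Ico 1 k, lamS (k - n) β T ≤ x ∨ muS n β T ≤ x := by
    refine (Filter.eventually_all_finset _).2 fun n hn => ?_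
    rw [Finset.mem_Ico] at hn
    rcases hpair n hn.1 hn.2 with h | h
    · exact (hle h).mono fun x => Or.inl
    · exact (hle h).mono fun x => Or.inr
  obtain ⟨x, hx, hx0, hxX⟩ := (hev.and ((hle h0).and self_mem_nhdsWithin)).exists
  refine (sigmaS_le (by omega) hβ hβ1 hT ?_).trans_lt hxX
  set A := {n : ℕ | 1 ≤ n ∧ lamS n β T ≤ x}
  set B := {n : ℕ | 1 ≤ n ∧ muS n β T ≤ x}
  have hA : A.Finite := finite_lamS_le hβ hβ1 hT x
  have hB : B.Finite := finite_muS_le hβ hβ1 hT x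
  have hsub : ((Finset.Ico 1 k : Finset ℕ) : Set ℕ) ⊆ (fun n => k - n) '' A ∪ B := by
    intro n hn
    have hn' := Finset.mem_coe.1 hn
    rw [Finset.mem_Ico] at hn'
    rcases hx n hn with h | h
    · exact Or.inl ⟨k - n, ⟨by omega, h⟩, by simp only; omega⟩
    · exact Or.inr ⟨hn'.1, h⟩
  have h1 := Set.ncard_le_ncard hsub ((hA.image _).union hB)
  have h2 := Set.ncard_union_le ((fun n => k - n) '' A) B
  have h3 := Set.ncard_image_le (f := fun n => k - n) hA
  rw [Set.ncard_coe_finset, Nat.card_Ico] at h1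
  rw [if_pos hx0]
  omega

lemma sigmaS_lt_of_lt {s β T : ℝ} {k : ℕ} (hs : 0 < s) (hsc : s = coth s) (hk : 1 ≤ k)
    (hβ : 0 < β) (hβ1 : β ≤ 1) (hT : 0 < T) (h : 2 * s / k < T) :
    sigmaS β T (2 * k - 1) < 4 * k * π / s := by
  have hk0 : (0 : ℝ) < k := by exact_mod_cast hk
  obtain ⟨w, rfl⟩ : ∃ w, T = 2 * s / k * w := ⟨T / (2 * s / k), by field_simp⟩
  have hw : 1 < w := by
    have : 0 < 2 * s / k := by positivity
    nlinarith
  have harg : ∀ n : ℕ, n * (2 * s / k * w) = 2 * (n * s / k) * w := fun n => by ring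
  rcases le_or_gt (β * w) 1 with hβw | hβw
  · refine (sigmaS_le_lamS hk hβ hβ1 hT).trans_lt (lamS_lt hk hk hβ hβ1 hT hs ?_)
    rw [harg, mul_div_cancel_left₀ s hk0.ne']
    exact lt_coth_add_sqrt_of_mul_le hs hsc hw hβ1 hβw
  · refine sigmaS_lt_of_pairs hk hβ hβ1 hT ?_ fun n hn hnk => ?_
    · rw [muS, if_pos rfl, div_lt_div_iff₀ (by positivity) hs]
      have : 4 * k * π * (2 * s / k * w * β) = 8 * π * s * (β * w) := by field_simp; ring
      rw [this]
      exact lt_mul_of_one_lt_right (by positivity) hβw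
    · have hn0 : (0 : ℝ) < n := by exact_mod_cast hn
      have hm0 : (0 : ℝ) < (k - n : ℕ) := by exact_mod_cast Nat.sub_pos_of_lt hnk
      have hsum : ((k - n : ℕ) : ℝ) * s / k + n * s / k = s := by
        rw [Nat.cast_sub hnk.le]
        field_simp
        ring
      refine (lt_coth_add_sqrt_or hs hsc hw hβ1 (by positivity) (by positivity) hsum).imp
        (fun h => ?_) fun h => ?_
      · exact lamS_lt (by omega) hk hβ hβ1 hT hs (by rwa [harg])
      · exact muS_lt hn hk hβ hs (by rwa [harg])

lemma lt_coth_add_sqrt_of_le {s t β : ℝ} (hsc : s = coth s) (ht : 0 < t) (hts : t ≤ s)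
    (hβ1 : β ≤ 1) (hne : ¬(β = 1 ∧ t = s)) :
    s < coth (2 * t) + √(coth (2 * t) ^ 2 - β) := by
  have hc := one_lt_coth (t := 2 * t) (by positivity)
  have h1 := coth_add_sqrt_one ht
  have h2 : √(coth (2 * t) ^ 2 - 1) ≤ √(coth (2 * t) ^ 2 - β) := by gcongr
  have h3 : s ≤ coth t := by
    nth_rewrite 1 [hsc]
    exact coth_strictAntiOn.antitoneOn (Set.mem_Ioi.2 ht) (Set.mem_Ioi.2 (by linarith)) hts
  rcases hts.lt_or_eq with hlt | rfl
  · have : coth s < coth t :=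
      coth_strictAntiOn (Set.mem_Ioi.2 ht) (Set.mem_Ioi.2 (by linarith)) hlt
    linarith
  · have hβ : β < 1 := lt_of_le_of_ne hβ1 fun h => hne ⟨h, rfl⟩
    have : √(coth (2 * t) ^ 2 - 1) < √(coth (2 * t) ^ 2 - β) :=
      sqrt_lt_sqrt (by nlinarith) (by linarith)
    linarith

lemma sigmaS_lt_of_le {s β T : ℝ} {k : ℕ} (hs : 0 < s) (hsc : s = coth s) (hk : 1 ≤ k)
    (hβ : 0 < β) (hβ1 : β ≤ 1) (hT : 0 < T) (h : T ≤ 2 * s / k)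
    (hne : ¬(β = 1 ∧ T = 2 * s / k)) :
    sigmaS β T (2 * k - 1) < 4 * k * π / s := by
  have hk0 : (0 : ℝ) < k := by exact_mod_cast hk
  refine (sigmaS_le_lamS hk hβ hβ1 hT).trans_lt (lamS_lt hk hk hβ hβ1 hT hs ?_)
  rw [mul_div_cancel_left₀ s hk0.ne', show k * T = 2 * (k * T / 2) by ring]
  rw [le_div_iff₀ hk0] at h
  refine lt_coth_add_sqrt_of_le hsc (by positivity) (by linarith) hβ1
    fun ⟨h1, h2⟩ => hne ⟨h1, ?_⟩
  rw [eq_div_iff hk0.ne']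
  linarith

lemma sigmaS_eq {s : ℝ} {k : ℕ} (hs : 0 < s) (hsc : s = coth s) (hk : 1 ≤ k) :
    sigmaS 1 (2 * s / k) (2 * k - 1) = 4 * k * π / s := by
  have hk0 : (0 : ℝ) < k := by exact_mod_cast hk
  have hT : 0 < 2 * s / k := by positivity
  have harg : ∀ n : ℕ, n * (2 * s / k) = 2 * (n * s / k) := fun n => by ring
  have hlam : lamS k 1 (2 * s / k) = 4 * k * π / s := by
    rw [lamS_eq hk one_pos le_rfl hT, harg, mul_div_cancel_left₀ s hk0.ne',
      coth_add_sqrt_one hs, ← hsc]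
  refine le_antisymm ((sigmaS_le_lamS hk one_pos le_rfl hT).trans_eq hlam) ?_
  refine le_csInf ⟨lamS k 1 (2 * s / k), ?_⟩ fun x hx => ?_
  · have := le_ncard_lamS_le k one_pos le_rfl hT
    rw [Set.mem_ofPred_eq]
    omega
  · by_contra! hlt
    have hA : {n : ℕ | 1 ≤ n ∧ lamS n 1 (2 * s / k) ≤ x} ⊆
        ((Finset.Ico 1 k : Finset ℕ) : Set ℕ) := by
      intro n ⟨hn, hnx⟩
      refine Finset.mem_coe.2 (Finset.mem_Ico.2 ⟨hn, ?_⟩)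
      by_contra! hkn
      have := lamS_mono hk hkn one_pos le_rfl hT
      linarith
    have hB : {n : ℕ | 1 ≤ n ∧ muS n 1 (2 * s / k) ≤ x} = ∅ := by
      ext n
      simp only [Set.mem_ofPred_eq, Set.mem_empty_iff_false, iff_false, not_and, not_le]
      intro hn
      have hn0 : (0 : ℝ) < n := by exact_mod_cast hn
      refine hlt.trans ?_
      have hy : 0 < n * s / k := by positivity
      rw [muS_eq hn, harg, coth_add_sqrt_one hy]
      have h1 := one_lt_mul_coth hy
      have h2 : 4 * n * π / 1 * coth (n * s / k)
          = 4 * k * π / s * (n * s / k * coth (n * s / k)) := by field_simp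
      rw [h2]
      exact lt_mul_of_one_lt_right (by positivity) h1
    have h0 : ¬ muS 0 1 (2 * s / k) ≤ x := by
      rw [not_le, muS, if_pos rfl]
      refine hlt.trans_eq ?_
      field_simp
      ring
    have hcard := Set.ncard_le_ncard hA (Finset.finite_toSet _)
    rw [Set.ncard_coe_finset, Nat.card_Ico] at hcard
    rw [Set.mem_ofPred_eq, hB, if_neg h0, Set.ncard_empty] at hx
    omega

theorem odd_eigenvalue_sup (s : ℝ) (hs : 0 < s) (hsc : s = coth s) (k : ℕ) (hk : 1 ≤ k) :
    (∀ β T : ℝ, 0 < β → β ≤ 1 → 0 < T →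
      sigmaS β T (2 * k - 1) ≤ 4 * k * π / s ∧
      (sigmaS β T (2 * k - 1) = 4 * k * π / s ↔ β = 1 ∧ T = 2 * s / k)) ∧
    sSup { x : ℝ | ∃ β T : ℝ, 0 < β ∧ β ≤ 1 ∧ 0 < T ∧ x = sigmaS β T (2 * k - 1) }
      = 4 * k * π / s := by
  have hlt : ∀ β T : ℝ, 0 < β → β ≤ 1 → 0 < T → ¬(β = 1 ∧ T = 2 * s / k) →
      sigmaS β T (2 * k - 1) < 4 * k * π / s := fun β T hβ hβ1 hT hne =>
    (le_or_gt T (2 * s / k)).elim (fun h => sigmaS_lt_of_le hs hsc hk hβ hβ1 hT h hne)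
      (sigmaS_lt_of_lt hs hsc hk hβ hβ1 hT)
  have hmain : ∀ β T : ℝ, 0 < β → β ≤ 1 → 0 < T →
      sigmaS β T (2 * k - 1) ≤ 4 * k * π / s ∧
      (sigmaS β T (2 * k - 1) = 4 * k * π / s ↔ β = 1 ∧ T = 2 * s / k) := by
    intro β T hβ hβ1 hT
    by_cases h : β = 1 ∧ T = 2 * s / k
    · obtain ⟨rfl, rfl⟩ := h
      have := sigmaS_eq hs hsc hk
      exact ⟨this.le, fun _ => ⟨rfl, rfl⟩, fun _ => this⟩
    · have := hlt β T hβ hβ1 hT h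
      exact ⟨this.le, fun h' => absurd h' this.ne, fun h' => absurd h' h⟩
  have hk0 : (0 : ℝ) < k := by exact_mod_cast hk
  refine ⟨hmain, IsGreatest.csSup_eq ⟨⟨1, 2 * s / k, one_pos, le_rfl, by positivity,
    (sigmaS_eq hs hsc hk).symm⟩, ?_⟩⟩
  rintro x ⟨β, T, hβ, hβ1, hT, rfl⟩
  exact (hmain β T hβ hβ1 hT).1
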